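/- arXiv:2305.02758 — 2 statements merged into one kernel-verified Lean document; each statement's English description precedes it below -/
import Mathlib

section
/- Let S be a compact Polish metric space, f : S → ℝ lower semicontinuous and bounded below, c : S × S → [0,∞) lower semicontinuous, μ ∈ P(S) and r > 0. Then the infimum of ∫_S f dν over ν ∈ B_r(μ) = { ν ∈ P(S) : d_c(μ, ν) ≤ r } equals the infimum of ∫_{S×S} f(y) dπ(x,y) over all π ∈ P(S × S) whose first marginal is μ and which satisfy ∫_{S×S} c(x,y) dπ(x,y) ≤ r. -/
open MeasureTheory

/-- The extended-real-valued integral `∫ g dπ ∈ [-∞, +∞]` of a real function, defined as the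
difference of the lower integrals of the positive and negative parts. -/
noncomputable def extInt {α : Type*} [MeasurableSpace α] (g : α → ℝ) (π : Measure α) : EReal :=
  ((∫⁻ a, ENNReal.ofReal (g a) ∂π : ENNReal) : EReal) -
    ((∫⁻ a, ENNReal.ofReal (-g a) ∂π : ENNReal) : EReal)

/-- The optimal transport cost `d_c(μ, ν)`: the infimum of `∫ c dπ` over all couplings `π` of
`μ` and `ν`. -/
noncomputable def optimalTransportCost {S : Type*} [MeasurableSpace S]
    (c : S × S → ℝ) (μ ν : Measure S) : ENNReal :=
  ⨅ (π : Measure (S × S)) (_ : π.map Prod.fst = μ ∧ π.map Prod.snd = ν),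
    ∫⁻ p, ENNReal.ofReal (c p) ∂π

open Filter Topology in
lemma exists_coupling_le {S : Type*} [MetricSpace S] [PolishSpace S]
    [CompactSpace S] [MeasurableSpace S] [BorelSpace S]
    (c : S × S → ℝ) (hc0 : ∀ p, 0 ≤ c p) (hc : LowerSemicontinuous c)
    (μ ν : Measure S) [IsProbabilityMeasure μ] (R : ENNReal) (hR : R ≠ ⊤)
    (h : optimalTransportCost c μ ν ≤ R) :
    ∃ π : Measure (S × S), IsProbabilityMeasure π ∧ π.map Prod.fst = μ ∧ π.map Prod.snd = ν ∧
      ∫⁻ p, ENNReal.ofReal (c p) ∂π ≤ R := by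
  have key : ∀ n : ℕ, ∃ π : Measure (S × S), (π.map Prod.fst = μ ∧ π.map Prod.snd = ν) ∧
      ∫⁻ p, ENNReal.ofReal (c p) ∂π < R + ((n : ENNReal) + 1)⁻¹ := by
    intro n
    have hlt : optimalTransportCost c μ ν < R + ((n : ENNReal) + 1)⁻¹ :=
      lt_of_le_of_lt h (ENNReal.lt_add_right hR (by simp))
    unfold optimalTransportCost at hlt
    simpa only [iInf_lt_iff, exists_prop] using hlt
  choose π hπ hcost using key
  have hprob : ∀ n, IsProbabilityMeasure (π n) := fun n => by
    constructor
    have h1 : (π n).map Prod.fst Set.univ = 1 := by rw [(hπ n).1]; simp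
    rwa [Measure.map_apply measurable_fst MeasurableSet.univ, Set.preimage_univ] at h1
  let P : ℕ → ProbabilityMeasure (S × S) := fun n => ⟨π n, hprob n⟩
  obtain ⟨Q, -, φ, hφ, hlim⟩ :=
    (isCompact_univ (X := ProbabilityMeasure (S × S))).isSeqCompact (x := P) (fun _ => trivial)
  have hmarg : ∀ (g : S × S → S) (hg : Continuous g) (ρ : Measure S) [IsProbabilityMeasure ρ],
      (∀ n, (π n).map g = ρ) → (Q : Measure (S × S)).map g = ρ := by
    intro g hg ρ _ hρ
    have h1 := ((ProbabilityMeasure.continuous_map hg).tendsto Q).comp hlim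
    have h2 : ((fun ν : ProbabilityMeasure (S × S) =>
        ProbabilityMeasure.map ν hg.measurable.aemeasurable) ∘ P ∘ φ)
        = fun _ => (⟨ρ, inferInstance⟩ : ProbabilityMeasure S) := by
      funext n
      apply Subtype.ext
      exact hρ (φ n)
    rw [h2] at h1
    have h3 := tendsto_nhds_unique h1 tendsto_const_nhds
    exact congrArg Subtype.val h3
  have hνp : IsProbabilityMeasure ν := by
    rw [← (hπ 0).2]
    have := hprob 0
    exact Measure.isProbabilityMeasure_map measurable_snd.aemeasurable
  refine ⟨Q, inferInstance, hmarg _ continuous_fst μ fun n => (hπ n).1,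
    hmarg _ continuous_snd ν fun n => (hπ n).2, ?_⟩
  have hlsc : ∫⁻ p, ENNReal.ofReal (c p) ∂(Q : Measure (S × S)) ≤
      atTop.liminf fun n => ∫⁻ p, ENNReal.ofReal (c p) ∂(π (φ n)) := by
    simp_rw [lintegral_eq_lintegral_meas_lt _ (Eventually.of_forall hc0) hc.measurable.aemeasurable]
    refine le_trans (lintegral_mono fun t => ?_) (lintegral_liminf_le fun n =>
      Antitone.measurable fun s t hst => measure_mono fun ω hω => lt_of_le_of_lt hst hω)
    exact ProbabilityMeasure.le_liminf_measure_open_of_tendsto hlim (hc.isOpen_preimage t)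
  refine hlsc.trans ?_
  have ht : Tendsto (fun n : ℕ => R + ((φ n : ENNReal) + 1)⁻¹) atTop (𝓝 R) := by
    have h1 : Tendsto (fun n : ℕ => R + ((n : ENNReal) + 1)⁻¹) atTop (𝓝 (R + 0)) := by
      refine Tendsto.const_add _ ?_
      have := (tendsto_add_atTop_iff_nat 1).2 ENNReal.tendsto_inv_nat_nhds_zero
      simpa using this
    rw [add_zero] at h1
    exact h1.comp hφ.tendsto_atTop
  rw [← ht.liminf_eq]
  exact liminf_le_liminf (Eventually.of_forall fun n => (hcost (φ n)).le)

lemma extInt_map_snd {S : Type*} [MeasurableSpace S] (f : S → ℝ) (hf : Measurable f)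
    (π : Measure (S × S)) : extInt f (π.map Prod.snd) = extInt (fun p => f p.2) π := by
  unfold extInt
  rw [lintegral_map (by fun_prop) measurable_snd, lintegral_map (by fun_prop) measurable_snd]

/-- The infimum of `∫ f dν` over the ball `B_r(μ) = {ν : d_c(μ, ν) ≤ r}`
equals the infimum of `∫ f(y) dπ(x, y)` over all couplings `π` with first marginal `μ` and
transport cost `∫ c dπ ≤ r`. -/
theorem primal_eq_couplings {S : Type*} [MetricSpace S] [PolishSpace S]
    [CompactSpace S] [MeasurableSpace S] [BorelSpace S]
    (f : S → ℝ) (hf : LowerSemicontinuous f) (hfb : BddBelow (Set.range f))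
    (c : S × S → ℝ) (hc0 : ∀ p, 0 ≤ c p) (hc : LowerSemicontinuous c)
    (μ : Measure S) [IsProbabilityMeasure μ] (r : ℝ) (hr : 0 < r) :
    (⨅ (ν : Measure S) (_ : IsProbabilityMeasure ν ∧
        optimalTransportCost c μ ν ≤ ENNReal.ofReal r), extInt f ν) =
    (⨅ (π : Measure (S × S)) (_ : IsProbabilityMeasure π ∧ π.map Prod.fst = μ ∧
        ∫⁻ p, ENNReal.ofReal (c p) ∂π ≤ ENNReal.ofReal r),
      extInt (fun p => f p.2) π) := by
  apply le_antisymm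
  · refine le_iInf₂ fun π hπ => ?_
    obtain ⟨h1, h2, h3⟩ := hπ
    rw [← extInt_map_snd f hf.measurable π]
    refine iInf₂_le _ ⟨Measure.isProbabilityMeasure_map measurable_snd.aemeasurable, ?_⟩
    exact (iInf₂_le π ⟨h2, rfl⟩).trans h3
  · refine le_iInf₂ fun ν hν => ?_
    obtain ⟨π, h1, h2, h3, h4⟩ :=
      exists_coupling_le c hc0 hc μ ν _ ENNReal.ofReal_ne_top hν.2
    rw [← h3, extInt_map_snd f hf.measurable π]
    exact iInf₂_le π ⟨h1, h2, h4⟩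
end

section
/- (Main duality, maximization form.) Let S be a compact Polish metric space, f : S → ℝ upper semicontinuous and bounded above, c : S × S → [0,∞) continuous, μ ∈ P(S) and θ > 0. Then sup { ∫_S f dν : ν ∈ P(S), d_c(μ, ν) ≤ θ } = inf_{λ ≥ 0} { λ θ + ∫_S max_{y ∈ S} { f(y) − λ c(x,y) } dμ(x) }. -/
open MeasureTheory

/-- `ψ_λ (x) = max_{y ∈ S} (f y − λ c (x, y))`, written as a supremum (which is attained, see
the first conjunct of the theorem below). -/
noncomputable def psiMax {S : Type*} (f : S → ℝ) (c : S × S → ℝ) (l : ℝ) (x : S) : ℝ :=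
  sSup (Set.range fun y => f y - l * c (x, y))


open Filter Topology Set

section Helpers

lemma psi_isGreatest {S : Type*} [TopologicalSpace S] [CompactSpace S] [Nonempty S]
    {f : S → ℝ} (hf : UpperSemicontinuous f) {c : S × S → ℝ} (hc : Continuous c)
    (l : ℝ) (x : S) :
    IsGreatest (Set.range fun y => f y - l * c (x, y)) (psiMax f c l x) := by
  have husc : UpperSemicontinuous fun y => f y + -(l * c (x, y)) :=
    hf.add (Continuous.upperSemicontinuous (by fun_prop))
  obtain ⟨b, -, hb⟩ := UpperSemicontinuousOn.exists_isMaxOn (s := Set.univ)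
    Set.univ_nonempty isCompact_univ (husc.upperSemicontinuousOn _)
  have hG : IsGreatest (Set.range fun y => f y - l * c (x, y)) (f b - l * c (x, b)) := by
    refine ⟨⟨b, rfl⟩, ?_⟩
    rintro _ ⟨y, rfl⟩
    have := hb (Set.mem_univ y)
    simp only [Set.mem_ofPred_eq] at this
    simpa [sub_eq_add_neg] using this
  unfold psiMax
  rw [hG.csSup_eq]
  exact hG

lemma le_psi {S : Type*} [TopologicalSpace S] [CompactSpace S] [Nonempty S]
    {f : S → ℝ} (hf : UpperSemicontinuous f) {c : S × S → ℝ} (hc : Continuous c)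
    (l : ℝ) (x y : S) : f y - l * c (x, y) ≤ psiMax f c l x :=
  (psi_isGreatest hf hc l x).2 ⟨y, rfl⟩

lemma exists_psi {S : Type*} [TopologicalSpace S] [CompactSpace S] [Nonempty S]
    {f : S → ℝ} (hf : UpperSemicontinuous f) {c : S × S → ℝ} (hc : Continuous c)
    (l : ℝ) (x : S) : ∃ y, f y - l * c (x, y) = psiMax f c l x :=
  (psi_isGreatest hf hc l x).1

lemma psi_continuous {S : Type*} [MetricSpace S] [CompactSpace S] [Nonempty S]
    {f : S → ℝ} (hf : UpperSemicontinuous f) {c : S × S → ℝ} (hc : Continuous c)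
    (l : ℝ) (hl : 0 ≤ l) : Continuous (psiMax f c l) := by
  have huc := CompactSpace.uniformContinuous_of_continuous hc
  rw [Metric.uniformContinuous_iff] at huc
  rw [Metric.continuous_iff]
  intro x ε hε
  obtain ⟨δ, hδ, h⟩ := huc (ε / (l + 1)) (by positivity)
  have key : ∀ a b : S, dist a b < δ → psiMax f c l a < psiMax f c l b + ε := by
    intro a b hab
    obtain ⟨y, hy⟩ := exists_psi hf hc l a
    have h1 := le_psi hf hc l b y
    have h2 : dist (c (a, y)) (c (b, y)) < ε / (l + 1) := by
      apply h
      rw [Prod.dist_eq]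
      simpa using hab
    rw [Real.dist_eq, abs_lt] at h2
    have h3 : l * (ε / (l + 1)) < ε := by
      rw [← mul_div_assoc, div_lt_iff₀ (by positivity)]
      nlinarith
    have h4 : l * (c (b, y) - c (a, y)) ≤ l * (ε / (l + 1)) :=
      mul_le_mul_of_nonneg_left (by linarith) hl
    linarith
  refine ⟨δ, hδ, fun a ha => ?_⟩
  rw [Real.dist_eq, abs_lt]
  have h1 := key a x ha
  have h2 := key x a (by rwa [dist_comm])
  constructor <;> linarith

lemma usc_approx {S : Type*} [MetricSpace S] [CompactSpace S] [Nonempty S]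
    {f : S → ℝ} (hf : UpperSemicontinuous f) {M : ℝ} (hM : ∀ x, f x ≤ M) :
    ∃ F : ℕ → S → ℝ, (∀ n, Continuous (F n)) ∧ (∀ n x, f x ≤ F n x) ∧ (∀ n x, F n x ≤ M) ∧
      (∀ m n, m ≤ n → ∀ x, F n x ≤ F m x) ∧ ∀ x, Tendsto (fun n => F n x) atTop (𝓝 (f x)) := by
  have hd : Continuous fun p : S × S => dist p.1 p.2 := by fun_prop
  have hge : ∀ (n : ℕ) x, f x ≤ psiMax f (fun p : S × S => dist p.1 p.2) n x := by
    intro n x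
    simpa using le_psi hf hd n x x
  refine ⟨fun n => psiMax f (fun p => dist p.1 p.2) n,
    fun n => psi_continuous hf hd n (Nat.cast_nonneg n), hge, ?_, ?_, ?_⟩
  · intro n x
    obtain ⟨y, hy⟩ := exists_psi hf hd n x
    have := hM y
    have : 0 ≤ (n : ℝ) * dist x y := by positivity
    simp only at hy ⊢
    linarith
  · intro m n hmn x
    obtain ⟨y, hy⟩ := exists_psi hf hd n x
    have h1 := le_psi hf hd m x y
    have : (m : ℝ) * dist x y ≤ n * dist x y :=
      mul_le_mul_of_nonneg_right (by exact_mod_cast hmn) dist_nonneg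
    simp only at hy h1 ⊢
    linarith
  · intro x
    rw [tendsto_order]
    refine ⟨fun a ha => Eventually.of_forall fun n => ha.trans_le (hge n x), fun a ha => ?_⟩
    obtain ⟨δ, hδ, h⟩ := Metric.eventually_nhds_iff.1 (hf x a ha)
    obtain ⟨N, hN⟩ := exists_nat_gt ((M - a) / δ)
    rw [div_lt_iff₀ hδ] at hN
    filter_upwards [eventually_ge_atTop N] with n hn
    obtain ⟨y, hy⟩ := exists_psi hf hd n x
    rw [← hy]
    simp only
    by_cases hxy : dist y x < δ
    · have := h hxy
      have : 0 ≤ (n : ℝ) * dist x y := by positivity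
      linarith
    · push Not at hxy
      rw [dist_comm] at hxy
      have h1 : (N : ℝ) * δ ≤ n * dist x y :=
        mul_le_mul (by exact_mod_cast hn) hxy hδ.le (Nat.cast_nonneg n)
      have := hM y
      linarith

lemma cont_integrable {X : Type*} [TopologicalSpace X] [CompactSpace X] [MeasurableSpace X]
    [OpensMeasurableSpace X] (g : X → ℝ) (hg : Continuous g) (π : Measure X)
    [IsFiniteMeasure π] : Integrable g π := by
  obtain ⟨C, hC⟩ := (isCompact_range hg.norm).bddAbove
  refine Integrable.of_bound hg.measurable.aestronglyMeasurable C ?_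
  exact Eventually.of_forall fun x => hC ⟨x, rfl⟩

lemma exists_near_opt {S : Type*} [MetricSpace S]
    [CompactSpace S] [MeasurableSpace S] [BorelSpace S] [Nonempty S]
    {F : S → ℝ} (hF : Continuous F) {c : S × S → ℝ} (hc : Continuous c)
    (μ : Measure S) [IsProbabilityMeasure μ] (l : ℝ) (hl : 0 ≤ l) (ε : ℝ) (hε : 0 < ε) :
    ∃ π : Measure (S × S), IsProbabilityMeasure π ∧ π.map Prod.fst = μ ∧
      ∫ x, psiMax F c l x ∂μ - ε ≤ ∫ p, F p.2 ∂π - l * ∫ p, c p ∂π := by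
  have hψ := psi_continuous hF.upperSemicontinuous hc l hl
  let u := TopologicalSpace.denseSeq S
  have hex : ∀ x, ∃ n, psiMax F c l x - ε < F (u n) - l * c (x, u n) := by
    intro x
    obtain ⟨y, hy⟩ := exists_psi hF.upperSemicontinuous hc l x
    have hcont : Continuous fun y => F y - l * c (x, y) := by fun_prop
    have ho : IsOpen {y | psiMax F c l x - ε < F y - l * c (x, y)} :=
      isOpen_lt continuous_const hcont
    obtain ⟨z, hz, n, rfl⟩ := (TopologicalSpace.denseRange_denseSeq S).inter_open_nonempty _ ho
      ⟨y, by simp only [Set.mem_ofPred_eq]; linarith⟩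
    exact ⟨n, hz⟩
  classical
  let N : S → ℕ := fun x => Nat.find (hex x)
  have hN : Measurable N := by
    apply measurable_find
    intro n
    exact (isOpen_lt (by fun_prop) (by fun_prop)).measurableSet
  have hsel : Measurable fun x => u (N x) := (measurable_from_nat (f := u)).comp hN
  have hmap : Measurable fun x => (x, u (N x)) := measurable_id.prodMk hsel
  have hprob : IsProbabilityMeasure (μ.map fun x => (x, u (N x))) :=
    Measure.isProbabilityMeasure_map hmap.aemeasurable
  refine ⟨μ.map fun x => (x, u (N x)), hprob, ?_, ?_⟩
  · rw [Measure.map_map measurable_fst hmap]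
    exact Measure.map_id
  · have hF2 : Continuous fun p : S × S => F p.2 := by fun_prop
    have hi1 := cont_integrable _ hF2 (μ.map fun x => (x, u (N x)))
    have hi2 := cont_integrable _ hc (μ.map fun x => (x, u (N x)))
    rw [← integral_const_mul, ← integral_sub hi1 (hi2.const_mul l),
      integral_map hmap.aemeasurable (by
        exact (hi1.sub (hi2.const_mul l)).aestronglyMeasurable)]
    have h1 : ∫ x, psiMax F c l x ∂μ - ε = ∫ x, (psiMax F c l x - ε) ∂μ := by
      rw [integral_sub (cont_integrable _ hψ μ) (integrable_const _)]
      simp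
    rw [h1]
    refine integral_mono ((cont_integrable _ hψ μ).sub (integrable_const _)) ?_ ?_
    · exact (hi1.sub (hi2.const_mul l)).comp_measurable hmap
    · intro x
      exact (Nat.find_spec (hex x)).le

lemma exists_relaxed {S : Type*} [MetricSpace S]
    [CompactSpace S] [MeasurableSpace S] [BorelSpace S] [Nonempty S]
    {F : S → ℝ} (hF : Continuous F) {c : S × S → ℝ} (hc : Continuous c)
    (μ : Measure S) [IsProbabilityMeasure μ] (θ v : ℝ)
    (hv : ∀ l, 0 ≤ l → v ≤ l * θ + ∫ x, psiMax F c l x ∂μ) (ε : ℝ) (hε : 0 < ε) :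
    ∃ π : Measure (S × S), IsProbabilityMeasure π ∧ π.map Prod.fst = μ ∧
      v - ε < ∫ p, F p.2 ∂π ∧ ∫ p, c p ∂π < θ + ε := by
  have hF2 : Continuous fun p : S × S => F p.2 := by fun_prop
  let A : Set (ℝ × ℝ) := {q | ∃ π : Measure (S × S), IsProbabilityMeasure π ∧
    π.map Prod.fst = μ ∧ q.1 < ∫ p, F p.2 ∂π ∧ ∫ p, c p ∂π < q.2}
  by_contra hcon
  have hnot : ((v - ε, θ + ε) : ℝ × ℝ) ∉ A := hcon
  have hopen : IsOpen A := by
    have : A = ⋃ (π : Measure (S × S)) (_ : IsProbabilityMeasure π ∧ π.map Prod.fst = μ),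
        {q : ℝ × ℝ | q.1 < ∫ p, F p.2 ∂π} ∩ {q : ℝ × ℝ | ∫ p, c p ∂π < q.2} := by
      ext q
      simp only [A, Set.mem_ofPred_eq, Set.mem_iUnion, Set.mem_inter_iff, exists_prop, and_assoc]
    rw [this]
    refine isOpen_iUnion fun π => isOpen_iUnion fun _ => ?_
    exact (isOpen_lt continuous_fst continuous_const).inter
      (isOpen_lt continuous_const continuous_snd)
  have hconv : Convex ℝ A := by
    rintro ⟨a, b⟩ ⟨π, hπ, hπμ, h1, h2⟩ ⟨a', b'⟩ ⟨π', hπ', hπμ', h1', h2'⟩ s t hs ht hst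
    have hmix : ∀ g : S × S → ℝ, Continuous g →
        ∫ p, g p ∂(ENNReal.ofReal s • π + ENNReal.ofReal t • π') =
          s * ∫ p, g p ∂π + t * ∫ p, g p ∂π' := by
      intro g hg
      rw [integral_add_measure, integral_smul_measure, integral_smul_measure,
        ENNReal.toReal_ofReal hs, ENNReal.toReal_ofReal ht, smul_eq_mul, smul_eq_mul]
      · exact (cont_integrable g hg π).smul_measure ENNReal.ofReal_ne_top
      · exact (cont_integrable g hg π').smul_measure ENNReal.ofReal_ne_top
    have hsum : ENNReal.ofReal s + ENNReal.ofReal t = 1 := by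
      rw [← ENNReal.ofReal_add hs ht, hst, ENNReal.ofReal_one]
    refine ⟨ENNReal.ofReal s • π + ENNReal.ofReal t • π', ⟨?_⟩, ?_, ?_, ?_⟩
    · simp [hsum]
    · rw [Measure.map_add _ _ measurable_fst, Measure.map_smul, Measure.map_smul, hπμ, hπμ',
        ← add_smul, hsum, one_smul]
    · rw [hmix _ hF2]
      simp only [Prod.fst_add, Prod.smul_fst, smul_eq_mul] at h1 h1' ⊢
      rcases hs.eq_or_lt with rfl | hs
      · have : t = 1 := by linarith
        subst this; linarith
      · have := mul_lt_mul_of_pos_left h1 hs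
        have := mul_le_mul_of_nonneg_left h1'.le ht
        linarith
    · rw [hmix _ hc]
      simp only [Prod.snd_add, Prod.smul_snd, smul_eq_mul] at h2 h2' ⊢
      rcases hs.eq_or_lt with rfl | hs
      · have : t = 1 := by linarith
        subst this; linarith
      · have := mul_lt_mul_of_pos_left h2 hs
        have := mul_le_mul_of_nonneg_left h2'.le ht
        linarith
  obtain ⟨φ, hφ⟩ := geometric_hahn_banach_open_point hconv hopen hnot
  set P := φ (1, 0) with hP
  set R := φ (0, 1) with hR
  have hφe : ∀ a b : ℝ, φ (a, b) = a * P + b * R := by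
    intro a b
    have : ((a, b) : ℝ × ℝ) = a • (1, 0) + b • (0, 1) := by ext <;> simp
    rw [this, map_add, map_smul, map_smul, smul_eq_mul, smul_eq_mul]
  -- strict inequality on the set
  have hstrict : ∀ π : Measure (S × S), IsProbabilityMeasure π → π.map Prod.fst = μ →
      ∀ s t : ℝ, 0 < s → 0 < t →
      (∫ p, F p.2 ∂π - s) * P + (∫ p, c p ∂π + t) * R < (v - ε) * P + (θ + ε) * R := by
    intro π h1 h2 s t hs ht
    have := hφ (∫ p, F p.2 ∂π - s, ∫ p, c p ∂π + t) ⟨π, h1, h2, by simpa using hs,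
      by simpa using ht⟩
    rwa [hφe, hφe] at this
  obtain ⟨π₀, hπ₀, hπ₀μ, -⟩ := exists_near_opt hF hc μ 0 le_rfl 1 one_pos
  set K := (v - ε) * P + (θ + ε) * R - (∫ p, F p.2 ∂π₀) * P - (∫ p, c p ∂π₀) * R with hK
  have hK' : ∀ s t : ℝ, 0 < s → 0 < t → -s * P + t * R < K := by
    intro s t hs ht
    have := hstrict π₀ hπ₀ hπ₀μ s t hs ht
    rw [hK]; linarith
  have hlim0 : ∀ (g : ℝ → ℝ) (B : ℝ), Continuous g → (∀ s, 0 < s → g s ≤ B) → g 0 ≤ B := by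
    intro g B hg h
    have ht : Tendsto g (𝓝[>] 0) (𝓝 (g 0)) := hg.continuousWithinAt
    exact le_of_tendsto ht (by filter_upwards [self_mem_nhdsWithin] with s hs using h s hs)
  have hP0 : 0 ≤ P := by
    by_contra hneg
    push Not at hneg
    have h1 : ∀ s : ℝ, 0 < s → -s * P ≤ K := fun s hs => by
      have := hlim0 (fun t => -s * P + t * R) K (by fun_prop) (fun t ht => (hK' s t hs ht).le)
      simpa using this
    have h2 := h1 ((|K| + 1) / (-P)) (div_pos (by positivity) (by linarith))
    have h3 : -((|K| + 1) / (-P)) * P = |K| + 1 := by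
      have hPne : P ≠ 0 := hneg.ne
      field_simp
    rw [h3] at h2
    linarith [le_abs_self K]
  have hR0 : R ≤ 0 := by
    by_contra hneg
    push Not at hneg
    have h1 : ∀ t : ℝ, 0 < t → t * R ≤ K := fun t ht => by
      have := hlim0 (fun s => -s * P + t * R) K (by fun_prop) (fun s hs => (hK' s t hs ht).le)
      simpa using this
    have h2 := h1 ((|K| + 1) / R) (div_pos (by positivity) (by linarith))
    have h3 : ((|K| + 1) / R) * R = |K| + 1 := by
      field_simp
    rw [h3] at h2
    linarith [le_abs_self K]
  have hmain : ∀ π : Measure (S × S), IsProbabilityMeasure π → π.map Prod.fst = μ →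
      (∫ p, F p.2 ∂π) * P + (∫ p, c p ∂π) * R ≤ (v - ε) * P + (θ + ε) * R := by
    intro π h1 h2
    have := hlim0 (fun s => (∫ p, F p.2 ∂π - s) * P + (∫ p, c p ∂π + s) * R) _ (by fun_prop)
      (fun s hs => (hstrict π h1 h2 s s hs hs).le)
    simpa using this
  rcases hP0.eq_or_lt with hPz | hPp
  · have hRn : R < 0 := by
      rcases hR0.eq_or_lt with h | h
      · have := hstrict π₀ hπ₀ hπ₀μ 1 1 one_pos one_pos
        rw [← hPz, h] at this
        simp at this
      · exact h
    obtain ⟨M, hM⟩ := (isCompact_range hF).bddAbove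
    have hM' : ∀ x, F x ≤ M := fun x => hM ⟨x, rfl⟩
    have hMl : ∀ l : ℝ, 0 ≤ l → v ≤ M + 1 - l * ε := by
      intro l hl
      obtain ⟨π, h1, h2, h3⟩ := exists_near_opt hF hc μ l hl 1 one_pos
      have h4 := hmain π h1 h2
      rw [← hPz] at h4
      have h5 : θ + ε ≤ ∫ p, c p ∂π := by nlinarith
      have h6 : ∫ p, F p.2 ∂π ≤ M := by
        have := integral_mono (cont_integrable _ hF2 π) (integrable_const M)
          (fun p => hM' p.2)
        simpa using this
      have h7 := mul_le_mul_of_nonneg_left h5 hl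
      have := hv l hl
      linarith
    have h0 := hMl ((|M + 2 - v|) / ε) (by positivity)
    rw [div_mul_cancel₀ _ hε.ne'] at h0
    linarith [le_abs_self (M + 2 - v)]
  · set l := -R / P with hl
    have hl0 : 0 ≤ l := div_nonneg (by linarith) hPp.le
    have hRl : R = -l * P := by rw [hl]; field_simp
    obtain ⟨π, h1, h2, h3⟩ := exists_near_opt hF hc μ l hl0 (ε / 2) (by positivity)
    have h4 := hmain π h1 h2
    rw [hRl] at h4
    have h5 : (∫ p, F p.2 ∂π) - l * (∫ p, c p ∂π) ≤ (v - ε) - l * (θ + ε) := by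
      refine le_of_mul_le_mul_right ?_ hPp
      linarith
    have := hv l hl0
    have : 0 ≤ l * ε := by positivity
    linarith

lemma extInt_of_integrable {α : Type*} [MeasurableSpace α] {g : α → ℝ} {π : Measure α}
    (hg : Integrable g π) : extInt g π = ((∫ a, g a ∂π : ℝ) : EReal) := by
  have h1 : ∫⁻ a, ENNReal.ofReal (g a) ∂π ≠ ⊤ := hg.lintegral_lt_top.ne
  have h2 : ∫⁻ a, ENNReal.ofReal (-g a) ∂π ≠ ⊤ := hg.neg.lintegral_lt_top.ne
  rw [integral_eq_lintegral_pos_part_sub_lintegral_neg_part hg, EReal.coe_sub, extInt,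
    EReal.coe_ennreal_toReal h1, EReal.coe_ennreal_toReal h2]

lemma extInt_of_not_integrable {α : Type*} [MeasurableSpace α] {g : α → ℝ} {π : Measure α}
    [IsFiniteMeasure π] (hm : Measurable g) {M : ℝ} (hM : ∀ x, g x ≤ M)
    (hg : ¬ Integrable g π) : extInt g π = ⊥ := by
  have h1 : ∫⁻ a, ENNReal.ofReal (g a) ∂π ≠ ⊤ := by
    refine ne_top_of_le_ne_top ?_ (lintegral_mono fun a => ENNReal.ofReal_le_ofReal (hM a))
    simpa using ENNReal.mul_ne_top ENNReal.ofReal_ne_top (measure_ne_top π univ)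
  have h2 : ∫⁻ a, ENNReal.ofReal (-g a) ∂π = ⊤ := by
    by_contra h2
    apply hg
    refine ⟨hm.aestronglyMeasurable, ?_⟩
    rw [hasFiniteIntegral_iff_norm]
    have : ∀ a, ENNReal.ofReal ‖g a‖ ≤ ENNReal.ofReal (g a) + ENNReal.ofReal (-g a) := by
      intro a
      rcases le_total 0 (g a) with h | h
      · rw [Real.norm_of_nonneg h]; exact le_self_add
      · rw [Real.norm_of_nonpos h]; exact le_add_self
    refine (lintegral_mono this).trans_lt ?_
    rw [lintegral_add_left hm.ennreal_ofReal]
    exact ENNReal.add_lt_top.2 ⟨lt_top_iff_ne_top.2 h1, lt_top_iff_ne_top.2 h2⟩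
  rw [extInt, h2, ← EReal.coe_ennreal_toReal h1]
  simp

lemma exists_opt {S : Type*} [MetricSpace S]
    [CompactSpace S] [MeasurableSpace S] [BorelSpace S] [Nonempty S]
    {f : S → ℝ} (hf : UpperSemicontinuous f) {M : ℝ} (hM : ∀ x, f x ≤ M)
    {c : S × S → ℝ} (hc : Continuous c)
    (μ : Measure S) [IsProbabilityMeasure μ] (θ v : ℝ)
    (hv : ∀ l, 0 ≤ l → v ≤ l * θ + ∫ x, psiMax f c l x ∂μ) :
    ∃ π : Measure (S × S), IsProbabilityMeasure π ∧ π.map Prod.fst = μ ∧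
      ∫ p, c p ∂π ≤ θ ∧ Integrable (fun p => f p.2) π ∧ v ≤ ∫ p, f p.2 ∂π := by
  obtain ⟨F, hFc, hfF, hFM, hFanti, hFlim⟩ := usc_approx hf hM
  have hF2 : ∀ n, Continuous fun p : S × S => F n p.2 := fun n => by
    have := hFc n; fun_prop
  let ε : ℕ → ℝ := fun n => 1 / ((n : ℝ) + 1)
  have hεpos : ∀ n, 0 < ε n := fun n => by positivity
  have hεanti : Antitone ε := fun m n h => one_div_le_one_div_of_le (by positivity)
    (by have : (m : ℝ) ≤ n := by exact_mod_cast h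
        linarith)
  have hεlim : Tendsto ε atTop (𝓝 0) := tendsto_one_div_add_atTop_nhds_zero_nat
  let K : ℕ → Set (ProbabilityMeasure (S × S)) := fun n =>
    {π | (π : Measure (S × S)).map Prod.fst = μ ∧ ∫ p, c p ∂(π : Measure (S × S)) ≤ θ + ε n ∧
      v - ε n ≤ ∫ p, F n p.2 ∂(π : Measure (S × S))}
  have hcontI : ∀ g : S × S → ℝ, Continuous g →
      Continuous fun π : ProbabilityMeasure (S × S) => ∫ p, g p ∂(π : Measure (S × S)) := by
    intro g hg
    exact ProbabilityMeasure.continuous_integral_continuousMap (⟨g, hg⟩ : C(S × S, ℝ))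
  have hclosed : ∀ n, IsClosed (K n) := by
    intro n
    have e1 : {π : ProbabilityMeasure (S × S) | (π : Measure (S × S)).map Prod.fst = μ} =
        (fun π : ProbabilityMeasure (S × S) => π.map (f := Prod.fst)
          measurable_fst.aemeasurable) ⁻¹'
          {(⟨μ, inferInstance⟩ : ProbabilityMeasure S)} := by
      ext π
      constructor
      · intro h
        exact Subtype.ext h
      · intro h
        exact congrArg Subtype.val h
    have c1 : IsClosed {π : ProbabilityMeasure (S × S) |
        (π : Measure (S × S)).map Prod.fst = μ} := by
      rw [e1]
      exact isClosed_singleton.preimage (ProbabilityMeasure.continuous_map continuous_fst)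
    exact c1.inter ((isClosed_le (hcontI c hc) continuous_const).inter
      (isClosed_le continuous_const (hcontI _ (hF2 n))))
  have hne : ∀ n, (K n).Nonempty := by
    intro n
    have hv' : ∀ l, 0 ≤ l → v ≤ l * θ + ∫ x, psiMax (F n) c l x ∂μ := by
      intro l hl
      refine (hv l hl).trans ?_
      gcongr
      · exact cont_integrable _ (psi_continuous hf hc l hl) μ
      · exact cont_integrable _ (psi_continuous (hFc n).upperSemicontinuous hc l hl) μ
      · intro x
        obtain ⟨y, hy⟩ := exists_psi hf hc l x
        have h1 := le_psi (hFc n).upperSemicontinuous hc l x y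
        have h2 := hfF n y
        simp only
        linarith
    obtain ⟨π, h1, h2, h3, h4⟩ := exists_relaxed (hFc n) hc μ θ v hv' (ε n) (hεpos n)
    exact ⟨⟨π, h1⟩, h2, h4.le, h3.le⟩
  have hdec : ∀ n, K (n + 1) ⊆ K n := by
    rintro n π ⟨h1, h2, h3⟩
    have he := hεanti (Nat.le_succ n)
    refine ⟨h1, h2.trans (by linarith), ?_⟩
    have h4 := integral_mono (cont_integrable _ (hF2 (n + 1)) (π : Measure (S × S)))
      (cont_integrable _ (hF2 n) (π : Measure (S × S)))
      (fun p => hFanti n (n + 1) (Nat.le_succ n) p.2)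
    linarith
  obtain ⟨π, hπ⟩ := IsCompact.nonempty_iInter_of_sequence_nonempty_isCompact_isClosed K hdec hne
    (hclosed 0).isCompact hclosed
  rw [Set.mem_iInter] at hπ
  have hle : ∀ n, ∫⁻ p, ENNReal.ofReal (M - F n p.2) ∂(π : Measure (S × S)) ≤
      ENNReal.ofReal (M - v + ε n) := by
    intro n
    have hi := cont_integrable _ (hF2 n) (π : Measure (S × S))
    rw [← ofReal_integral_eq_lintegral_ofReal
      (f := fun p : S × S => M - F n p.2) ((integrable_const M).sub hi)
      (Eventually.of_forall fun p => by simpa using hFM n p.2)]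
    apply ENNReal.ofReal_le_ofReal
    rw [integral_sub (integrable_const M) hi]
    have := (hπ n).2.2
    simp
    linarith
  have hmono : Monotone fun n (p : S × S) => ENNReal.ofReal (M - F n p.2) := by
    intro m n hmn p
    apply ENNReal.ofReal_le_ofReal
    have := hFanti m n hmn p.2
    linarith
  have hsup : ∫⁻ p, ENNReal.ofReal (M - f p.2) ∂(π : Measure (S × S)) ≤ ENNReal.ofReal (M - v) := by
    have ht := lintegral_tendsto_of_tendsto_of_monotone (μ := (π : Measure (S × S)))
      (f := fun n (p : S × S) => ENNReal.ofReal (M - F n p.2))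
      (F := fun p => ENNReal.ofReal (M - f p.2))
      (fun n => ((measurable_const.sub (hF2 n).measurable).ennreal_ofReal).aemeasurable)
      (Eventually.of_forall fun p m n hmn => hmono hmn p)
      (Eventually.of_forall fun p => (ENNReal.continuous_ofReal.tendsto _).comp
        (tendsto_const_nhds.sub (hFlim p.2)))
    have ht2 : Tendsto (fun n => ENNReal.ofReal (M - v + ε n)) atTop
        (𝓝 (ENNReal.ofReal (M - v + 0))) :=
      (ENNReal.continuous_ofReal.tendsto _).comp (tendsto_const_nhds.add hεlim)
    rw [add_zero] at ht2
    exact le_of_tendsto_of_tendsto' ht ht2 hle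
  have hfm : Measurable fun p : S × S => f p.2 := hf.measurable.comp measurable_snd
  have hMf : Integrable (fun p : S × S => M - f p.2) (π : Measure (S × S)) := by
    refine ⟨(measurable_const.sub hfm).aestronglyMeasurable, ?_⟩
    rw [hasFiniteIntegral_iff_ofReal (Eventually.of_forall fun p => by simpa using hM p.2)]
    exact hsup.trans_lt ENNReal.ofReal_lt_top
  have hfi : Integrable (fun p : S × S => f p.2) (π : Measure (S × S)) := by
    have := (integrable_const M).sub hMf
    refine this.congr (Eventually.of_forall fun p => ?_)
    simp
  have hvM : v ≤ M := by
    have h1 : ∀ n, v - ε n ≤ M := fun n => by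
      have h2 := integral_mono (cont_integrable _ (hF2 n) (π : Measure (S × S)))
        (integrable_const M) (fun p => hFM n p.2)
      have h3 := (hπ n).2.2
      simp at h2
      linarith
    have : Tendsto (fun n => v - ε n) atTop (𝓝 (v - 0)) := tendsto_const_nhds.sub hεlim
    rw [sub_zero] at this
    exact le_of_tendsto' this h1
  refine ⟨π, inferInstance, (hπ 0).1, ?_, hfi, ?_⟩
  · have : Tendsto (fun n => θ + ε n) atTop (𝓝 (θ + 0)) := tendsto_const_nhds.add hεlim
    rw [add_zero] at this
    exact ge_of_tendsto' this fun n => (hπ n).2.1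
  · rw [← ofReal_integral_eq_lintegral_ofReal hMf
      (Eventually.of_forall fun p => by simpa using hM p.2),
      ENNReal.ofReal_le_ofReal_iff (by linarith), integral_sub (integrable_const M) hfi] at hsup
    simp at hsup
    linarith

lemma weak_duality {S : Type*} [MetricSpace S]
    [CompactSpace S] [MeasurableSpace S] [BorelSpace S] [Nonempty S]
    {f : S → ℝ} (hf : UpperSemicontinuous f)
    {c : S × S → ℝ} (hc0 : ∀ p, 0 ≤ c p) (hc : Continuous c)
    (μ : Measure S) [IsProbabilityMeasure μ] (θ : ℝ) (hθ : 0 < θ)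
    (ν : Measure S) (hν : IsProbabilityMeasure ν)
    (hcost : optimalTransportCost c μ ν ≤ ENNReal.ofReal θ) (hfi : Integrable f ν)
    (l : ℝ) (hl : 0 ≤ l) : ∫ x, f x ∂ν ≤ l * θ + ∫ x, psiMax f c l x ∂μ := by
  have hψ := psi_continuous hf hc l hl
  have key : ∀ ε : ℝ, 0 < ε → ∫ x, f x ∂ν ≤ l * (θ + ε) + ∫ x, psiMax f c l x ∂μ := by
    intro ε hε
    have hlt : optimalTransportCost c μ ν < ENNReal.ofReal (θ + ε) :=
      hcost.trans_lt ((ENNReal.ofReal_lt_ofReal_iff (by linarith)).2 (by linarith))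
    unfold optimalTransportCost at hlt
    simp only [iInf_lt_iff] at hlt
    obtain ⟨π, ⟨h1, h2⟩, h3⟩ := hlt
    have hprob : IsProbabilityMeasure π := by
      constructor
      have : π.map Prod.fst univ = 1 := by rw [h1]; simp
      rwa [Measure.map_apply measurable_fst MeasurableSet.univ, preimage_univ] at this
    have hci := cont_integrable c hc π
    have hψ2 : Continuous fun p : S × S => psiMax f c l p.1 := by fun_prop
    have hψi := cont_integrable _ hψ2 π
    rw [← ofReal_integral_eq_lintegral_ofReal hci (Eventually.of_forall hc0),
      ENNReal.ofReal_lt_ofReal_iff (by linarith)] at h3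
    have hfi' : Integrable (fun p : S × S => f p.2) π := by
      rw [← h2] at hfi
      exact hfi.comp_measurable measurable_snd
    have e1 : ∫ x, f x ∂ν = ∫ p, f p.2 ∂π := by
      rw [← h2, integral_map measurable_snd.aemeasurable
        hf.measurable.aestronglyMeasurable]
    have e2 : ∫ x, psiMax f c l x ∂μ = ∫ p, psiMax f c l p.1 ∂π := by
      rw [← h1, integral_map measurable_fst.aemeasurable
        hψ.measurable.aestronglyMeasurable]
    rw [e1, e2]
    have h4 : ∫ p, f p.2 ∂π ≤ ∫ p, (l * c p + psiMax f c l p.1) ∂π := by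
      refine integral_mono hfi' ((hci.const_mul l).add hψi) fun p => ?_
      have := le_psi hf hc l p.1 p.2
      simp only [Prod.mk.eta] at this ⊢
      linarith
    rw [integral_add (hci.const_mul l) hψi, integral_const_mul] at h4
    have := mul_le_mul_of_nonneg_left h3.le hl
    linarith
  have ht : Tendsto (fun ε : ℝ => l * (θ + ε) + ∫ x, psiMax f c l x ∂μ) (𝓝[>] 0)
      (𝓝 (l * (θ + 0) + ∫ x, psiMax f c l x ∂μ)) :=
    Continuous.continuousWithinAt (f := fun ε : ℝ => l * (θ + ε) + ∫ x, psiMax f c l x ∂μ)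
      (by fun_prop)
  rw [add_zero] at ht
  exact ge_of_tendsto ht (by filter_upwards [self_mem_nhdsWithin] with s hs using key s hs)

end Helpers

/-- main duality, maximization form.  For `S` a compact Polish metric
space, `f` upper semicontinuous and bounded above, `c ≥ 0` continuous, `μ ∈ P(S)` and `θ > 0`:
`sup { ∫ f dν : d_c(μ, ν) ≤ θ } = inf_{λ ≥ 0} (λ θ + ∫ max_{y} (f y − λ c (x, y)) dμ(x))`
(and the maximum in the dual integrand is attained). -/
theorem main_duality_max {S : Type*} [MetricSpace S] [PolishSpace S]
    [CompactSpace S] [MeasurableSpace S] [BorelSpace S]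
    (f : S → ℝ) (hf : UpperSemicontinuous f) (hfb : BddAbove (Set.range f))
    (c : S × S → ℝ) (hc0 : ∀ p, 0 ≤ c p) (hc : Continuous c)
    (μ : Measure S) [IsProbabilityMeasure μ] (θ : ℝ) (hθ : 0 < θ) :
    (∀ l : ℝ, 0 ≤ l → ∀ x : S,
      IsGreatest (Set.range fun y => f y - l * c (x, y)) (psiMax f c l x)) ∧
    (⨆ (ν : Measure S) (_ : IsProbabilityMeasure ν ∧
        optimalTransportCost c μ ν ≤ ENNReal.ofReal θ), extInt f ν) =
    (⨅ (l : ℝ) (_ : 0 ≤ l), ((l * θ : ℝ) : EReal) + extInt (psiMax f c l) μ) := by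
  have hne : Nonempty S := by
    by_contra h
    rw [not_nonempty_iff] at h
    have h1 : μ univ = 1 := measure_univ
    rw [univ_eq_empty_iff.2 h] at h1
    simp at h1
  obtain ⟨M, hM⟩ := hfb
  have hM' : ∀ x, f x ≤ M := fun x => hM ⟨x, rfl⟩
  refine ⟨fun l _ x => psi_isGreatest hf hc l x, ?_⟩
  have hext : ∀ l : ℝ, 0 ≤ l → ((l * θ : ℝ) : EReal) + extInt (psiMax f c l) μ =
      ((l * θ + ∫ x, psiMax f c l x ∂μ : ℝ) : EReal) := by
    intro l hl
    rw [extInt_of_integrable (cont_integrable _ (psi_continuous hf hc l hl) μ), EReal.coe_add]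
  apply le_antisymm
  · refine iSup₂_le fun ν hν => le_iInf₂ fun l hl => ?_
    rw [hext l hl]
    obtain ⟨hν1, hν2⟩ := hν
    by_cases hfi : Integrable f ν
    · rw [extInt_of_integrable hfi]
      exact EReal.coe_le_coe_iff.2 (weak_duality hf hc0 hc μ θ hθ ν hν1 hν2 hfi l hl)
    · rw [extInt_of_not_integrable hf.measurable hM' hfi]
      exact bot_le
  · generalize hV : (⨅ (l : ℝ) (_ : 0 ≤ l),
      ((l * θ : ℝ) : EReal) + extInt (psiMax f c l) μ) = V
    have hVle : ∀ l : ℝ, 0 ≤ l → V ≤ ((l * θ + ∫ x, psiMax f c l x ∂μ : ℝ) : EReal) := by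
      intro l hl
      rw [← hext l hl, ← hV]
      exact iInf₂_le l hl
    induction V with
    | bot => exact bot_le
    | top =>
      have := hVle 0 le_rfl
      exact absurd this (by simp only [top_le_iff]; exact EReal.coe_ne_top _)
    | coe v =>
      obtain ⟨π, hπ, h1, h2, h3, h4⟩ := exists_opt hf hM' hc μ θ v
        (fun l hl => EReal.coe_le_coe_iff.1 (hVle l hl))
      have hprob : IsProbabilityMeasure (π.map Prod.snd) :=
        Measure.isProbabilityMeasure_map measurable_snd.aemeasurable
      have hi : Integrable f (π.map Prod.snd) :=
        (integrable_map_measure hf.measurable.aestronglyMeasurable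
          measurable_snd.aemeasurable).2 h3
      refine le_trans ?_ (le_iSup₂ (f := fun (ν : Measure S) (_ : IsProbabilityMeasure ν ∧
        optimalTransportCost c μ ν ≤ ENNReal.ofReal θ) => extInt f ν) (π.map Prod.snd)
        ⟨hprob, ?_⟩)
      · rw [extInt_of_integrable hi, integral_map measurable_snd.aemeasurable
          hf.measurable.aestronglyMeasurable]
        exact EReal.coe_le_coe_iff.2 h4
      · refine (iInf₂_le π ⟨h1, rfl⟩).trans ?_
        rw [← ofReal_integral_eq_lintegral_ofReal (cont_integrable c hc π)
          (Eventually.of_forall hc0)]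
        exact ENNReal.ofReal_le_ofReal h2
end
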